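/- arXiv:1112.0128 — 2 statements merged into one kernel-verified Lean document; each statement's English description precedes it below -/
import Mathlib

section
/- Let n ≥ 2, let p be a prime, and fix 1 ≤ i ≤ n. Let η_i : ℤ_p^{n-1} → ℤ_p^n be the map η_i(x_1,…,x_{n-1}) = (x_1,…,x_{i-1}, 1, x_i,…,x_{n-1}). Then for every Borel measurable set M ⊆ ℤ_p^{n-1}, μ_p(φ(η_i(M))) = ((p^n − p^{n-1})/(p^n − 1)) · β^{n-1}(M), where β^{n-1} is the Haar measure on ℚ_p^{n-1} normalized so that β^{n-1}(ℤ_p^{n-1}) = 1. -/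
open MeasureTheory

noncomputable section

/-- The p-adic projective distance (at vector level): the sup-norm of the wedge product
divided by the product of sup norms.  Invariant under scaling, it descends to
projective space. -/
def padicDelta (p : ℕ) [Fact p.Prime] {n : ℕ} (x y : Fin n → ℚ_[p]) : ℝ :=
  (⨆ ij : Fin n × Fin n, ‖x ij.1 * y ij.2 - x ij.2 * y ij.1‖) / (‖x‖ * ‖y‖)

instance (p : ℕ) [Fact p.Prime] (n : ℕ) : MeasurableSpace (Fin n → ℚ_[p]) := borel _
instance (p : ℕ) [Fact p.Prime] (n : ℕ) : BorelSpace (Fin n → ℚ_[p]) := ⟨rfl⟩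

/-- `ℤ_p^n` as a positive compact subset of `ℚ_p^n`. -/
def padicUnitPC (p : ℕ) [Fact p.Prime] (n : ℕ) :
    TopologicalSpace.PositiveCompacts (Fin n → ℚ_[p]) where
  carrier := {x | ∀ i, ‖x i‖ ≤ 1}
  isCompact' := by
    have : {x : Fin n → ℚ_[p] | ∀ i, ‖x i‖ ≤ 1} = Set.univ.pi fun _ => Metric.closedBall 0 1 := by
      ext x; simp [Metric.mem_closedBall, dist_eq_norm]
    rw [this]
    exact isCompact_univ_pi fun i => isCompact_closedBall 0 1
  interior_nonempty' := by
    refine ⟨0, ?_⟩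
    rw [mem_interior]
    refine ⟨Metric.ball 0 1, fun x hx i => ?_, Metric.isOpen_ball, by simp⟩
    have hx' : ‖x‖ < 1 := by simpa [dist_eq_norm] using hx
    exact le_of_lt (lt_of_le_of_lt (norm_le_pi_norm x i) hx')

/-- Haar measure on `ℚ_p^n`, normalized so that `ℤ_p^n` has measure one. -/
def padicHaar (p : ℕ) [Fact p.Prime] (n : ℕ) : Measure (Fin n → ℚ_[p]) :=
  Measure.addHaarMeasure (padicUnitPC p n)

/-- The natural probability measure `μ_p` on `ℙ^{n-1}(ℚ_p)`:
`μ_p(M) = β(φ⁻¹(M) ∩ ℤ_p^n)`. -/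
def muP (p : ℕ) [Fact p.Prime] (n : ℕ)
    (M : Set (Projectivization ℚ_[p] (Fin n → ℚ_[p]))) : ENNReal :=
  padicHaar p n {x | (∀ i, ‖x i‖ ≤ 1) ∧ ∃ hx : x ≠ 0, Projectivization.mk ℚ_[p] x hx ∈ M}

/-- A visible (primitive) integer vector: the gcd of its coordinates is 1. -/
def IsPrim {n : ℕ} (v : Fin n → ℤ) : Prop := Finset.univ.gcd v = 1

/-- The sup-norm height of an integer vector. -/
def Hsup {n : ℕ} (v : Fin n → ℤ) : ℕ := Finset.univ.sup fun i => (v i).natAbs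

/-- Embedding of an integer vector into `ℚ_p^n`. -/
def intPadic (p : ℕ) [Fact p.Prime] {n : ℕ} (v : Fin n → ℤ) : Fin n → ℚ_[p] :=
  fun i => ((v i : ℤ) : ℚ_[p])

/-- Embedding of an integer vector into `ℚ^n`. -/
def intRat {n : ℕ} (v : Fin n → ℤ) : Fin n → ℚ := fun i => ((v i : ℤ) : ℚ)

/-- The set `W_p(ψ, ℚ, n)` of points of `ℙ^{n-1}(ℚ_p)` admitting infinitely many
rational approximations `y` with `δ_p(x,y) ≤ ψ(H(y))`. -/
def Wp (p : ℕ) [Fact p.Prime] (n : ℕ) (ψ : ℕ → ℝ) :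
    Set (Projectivization ℚ_[p] (Fin n → ℚ_[p])) :=
  {x | {y : Projectivization ℚ (Fin n → ℚ) | ∃ v : Fin n → ℤ, IsPrim v ∧
      (∃ hv : intRat v ≠ 0, y = Projectivization.mk ℚ (intRat v) hv) ∧
      padicDelta p x.rep (intPadic p v) ≤ ψ (Hsup v)}.Infinite}

/-- Closed ball for the projective metric, centered at the class of the vector `y`. -/
def Bdelta (p : ℕ) [Fact p.Prime] {n : ℕ} (y : Fin n → ℚ_[p]) (r : ℝ) :
    Set (Projectivization ℚ_[p] (Fin n → ℚ_[p])) :=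
  {z | padicDelta p z.rep y ≤ r}

/-- The Euclidean norm of a vector in `ℝ^n`. -/
noncomputable def eNorm {n : ℕ} (x : Fin n → ℝ) : ℝ := Real.sqrt (∑ i, (x i) ^ 2)

/-- Norm of the wedge product of two vectors in `ℝ^n`:
`‖x ∧ y‖² = Σ_{i<j} (x_i y_j − x_j y_i)²`. -/
noncomputable def wedgeNorm {n : ℕ} (x y : Fin n → ℝ) : ℝ :=
  Real.sqrt (∑ ij ∈ Finset.univ.filter (fun ij : Fin n × Fin n => ij.1 < ij.2),
    (x ij.1 * y ij.2 - x ij.2 * y ij.1) ^ 2)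

/-- The projective distance at the infinite place (vector level):
`δ_∞(x,y) = ‖x ∧ y‖ / (‖x‖‖y‖)`. Invariant under scaling, it descends to `ℙ^{n-1}(ℝ)`. -/
noncomputable def deltaInf {n : ℕ} (x y : Fin n → ℝ) : ℝ :=
  wedgeNorm x y / (eNorm x * eNorm y)

/-- Embedding of an integer vector into `ℝ^n`. -/
noncomputable def intReal {n : ℕ} (v : Fin n → ℤ) : Fin n → ℝ := fun i => ((v i : ℤ) : ℝ)

/-- The natural probability measure `μ_∞` on `ℙ^{n-1}(ℝ)`:
`μ_∞(M) = λ(φ⁻¹(M) ∩ B(0,1)) / λ(B(0,1))`. -/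
noncomputable def muInf (n : ℕ) (M : Set (Projectivization ℝ (Fin n → ℝ))) : ENNReal :=
  MeasureTheory.volume {x : Fin n → ℝ | eNorm x ≤ 1 ∧
      ∃ hx : x ≠ 0, Projectivization.mk ℝ x hx ∈ M} /
    MeasureTheory.volume {x : Fin n → ℝ | eNorm x ≤ 1}

/-- The set `W_∞(ψ, ℚ, n)` of points of `ℙ^{n-1}(ℝ)` admitting infinitely many
rational approximations `y` with `δ_∞(x,y) ≤ ψ(H(y))`. -/
noncomputable def Winf (n : ℕ) (ψ : ℕ → ℝ) : Set (Projectivization ℝ (Fin n → ℝ)) :=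
  {x | {y : Projectivization ℚ (Fin n → ℚ) | ∃ v : Fin n → ℤ, IsPrim v ∧
      (∃ hv : intRat v ≠ 0, y = Projectivization.mk ℚ (intRat v) hv) ∧
      deltaInf x.rep (intReal v) ≤ ψ (Hsup v)}.Infinite}

/-- The Choi–Vaaler constant `c(n) = 2·π^{-1/2}·Γ(n/2+1)^{1/n}` for `k = ℚ`. -/
noncomputable def cCV (n : ℕ) : ℝ :=
  2 * Real.pi ^ (-(1/2 : ℝ)) * Real.Gamma ((n : ℝ) / 2 + 1) ^ ((1 : ℝ) / n)

/-- The Euclidean height of a primitive integer vector. -/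
noncomputable def He {n : ℕ} (v : Fin n → ℤ) : ℝ := eNorm (intReal v)

end

open scoped Pointwise

instance padicHaar.isAddHaarMeasure (p : ℕ) [Fact p.Prime] (n : ℕ) :
    (padicHaar p n).IsAddHaarMeasure := by
  unfold padicHaar; infer_instance

instance padicHaar.regular (p : ℕ) [Fact p.Prime] (n : ℕ) : (padicHaar p n).Regular := by
  unfold padicHaar; infer_instance

/-- The unit ball has measure one. -/
theorem padicHaar_unitBall (p : ℕ) [Fact p.Prime] (n : ℕ) :
    padicHaar p n {x | ∀ i, ‖x i‖ ≤ 1} = 1 :=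
  Measure.addHaarMeasure_self (K₀ := padicUnitPC p n)

theorem Padic.existsUnique_norm_sub_natCast_lt_one {p : ℕ} [Fact p.Prime] {x : ℚ_[p]}
    (hx : ‖x‖ ≤ 1) : ∃! c : Fin p, ‖x - ((c : ℕ) : ℚ_[p])‖ < 1 := by
  have key : ∀ m : ℕ, (show ℤ_[p] from ⟨x, hx⟩) - (m : ℤ_[p]) ∈ IsLocalRing.maximalIdeal ℤ_[p] ↔
      ‖x - (m : ℚ_[p])‖ < 1 := by
    intro m
    rw [IsLocalRing.mem_maximalIdeal, PadicInt.mem_nonunits, PadicInt.norm_def, PadicInt.coe_sub,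
      PadicInt.coe_natCast]
  obtain ⟨m, ⟨hm, hm'⟩, hu⟩ := PadicInt.existsUnique_mem_range (⟨x, hx⟩ : ℤ_[p])
  refine ⟨⟨m, hm⟩, (key m).1 hm', fun c hc => Fin.ext (hu c ⟨c.2, (key c).2 hc⟩)⟩

/-- `p` as a unit of `ℚ_p`. -/
noncomputable def padicPUnit (p : ℕ) [Fact p.Prime] : ℚ_[p]ˣ :=
  Units.mk0 (p : ℚ_[p]) (Nat.cast_ne_zero.2 (Fact.out : p.Prime).ne_zero)

theorem Padic.norm_inv_p_mul_le_one_iff {p : ℕ} [Fact p.Prime] {x : ℚ_[p]} :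
    ‖(p : ℚ_[p])⁻¹ * x‖ ≤ 1 ↔ ‖x‖ < 1 := by
  have hp : (0 : ℝ) < p := mod_cast (Fact.out : p.Prime).pos
  have := Padic.norm_le_pow_iff_norm_lt_pow_add_one x (-1)
  rw [neg_add_cancel, zpow_zero, zpow_neg_one] at this
  rw [← this, norm_mul, norm_inv, Padic.norm_p, inv_inv, ← le_inv_mul_iff₀ hp, mul_one]

theorem padicPUnit_smul_unitBall (p : ℕ) [Fact p.Prime] (n : ℕ) :
    padicPUnit p • {x : Fin n → ℚ_[p] | ∀ i, ‖x i‖ ≤ 1} = {x | ∀ i, ‖x i‖ < 1} := by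
  ext x
  rw [Set.mem_smul_set_iff_inv_smul_mem]
  simp only [Set.mem_ofPred_eq, Units.smul_def, Pi.smul_apply,
    padicPUnit, Units.val_inv_eq_inv_val, Units.val_mk0, smul_eq_mul,
    Padic.norm_inv_p_mul_le_one_iff]

theorem padicHaar_openUnitBall (p : ℕ) [Fact p.Prime] (n : ℕ) :
    padicHaar p n {x | ∀ i, ‖x i‖ < 1} = ((p : ENNReal) ^ n)⁻¹ := by
  set V : Set (Fin n → ℚ_[p]) := {x | ∀ i, ‖x i‖ < 1} with hV
  have hVm : MeasurableSet V := by
    have : IsOpen V := by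
      simp only [hV, Set.ofPred_forall]
      exact isOpen_iInter_of_finite fun i => isOpen_lt (by fun_prop) continuous_const
    exact this.measurableSet
  let t (c : Fin n → Fin p) : Fin n → ℚ_[p] := fun i => ((c i : ℕ) : ℚ_[p])
  have hU : {x : Fin n → ℚ_[p] | ∀ i, ‖x i‖ ≤ 1} = ⋃ c, (fun x => x - t c) ⁻¹' V := by
    ext x
    simp only [Set.mem_ofPred_eq, Set.mem_iUnion, Set.mem_preimage, hV, Pi.sub_apply, t]
    constructor
    · intro h
      choose c hc using fun i => (Padic.existsUnique_norm_sub_natCast_lt_one (h i)).exists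
      exact ⟨c, hc⟩
    · rintro ⟨c, hc⟩ i
      have := Padic.nonarchimedean (x i - ((c i : ℕ) : ℚ_[p])) ((c i : ℕ) : ℚ_[p])
      rw [sub_add_cancel] at this
      exact this.trans (max_le (hc i).le (Padic.norm_int_le_one (c i : ℕ)))
  have hd : Pairwise (Function.onFun Disjoint fun c => (fun x => x - t c) ⁻¹' V) := by
    intro c d hcd
    rw [Function.onFun, Set.disjoint_left]
    intro x hc hd
    have hx : ∀ i, ‖x i‖ ≤ 1 := by
      have : x ∈ {x : Fin n → ℚ_[p] | ∀ i, ‖x i‖ ≤ 1} := hU ▸ Set.mem_iUnion.2 ⟨c, hc⟩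
      exact this
    exact hcd (funext fun i =>
      (Padic.existsUnique_norm_sub_natCast_lt_one (hx i)).unique (hc i) (hd i))
  have h := padicHaar_unitBall p n
  rw [hU, measure_iUnion hd fun c => (by fun_prop : Measurable fun x => x - t c) hVm] at h
  simp only [sub_eq_add_neg, measure_preimage_add_right, tsum_fintype, Finset.sum_const, Finset.card_univ,
    Fintype.card_fun, Fintype.card_fin, nsmul_eq_mul, Nat.cast_pow] at h
  exact ENNReal.eq_inv_of_mul_eq_one_left (by rwa [mul_comm])

theorem padicHaar_p_smul (p : ℕ) [Fact p.Prime] (n : ℕ) (s : Set (Fin n → ℚ_[p])) :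
    padicHaar p n (padicPUnit p • s) = ((p : ENNReal) ^ n)⁻¹ * padicHaar p n s := by
  rw [← distribHaarChar_mul (padicHaar p n) (padicPUnit p) s]
  congr 1
  rw [distribHaarChar_eq_div (μ := padicHaar p n) (s := {x | ∀ i, ‖x i‖ ≤ 1})
    (by simp [padicHaar_unitBall]) (by simp [padicHaar_unitBall]), padicPUnit_smul_unitBall, padicHaar_unitBall,
    padicHaar_openUnitBall, div_one]

theorem padicHaar_unit_smul {p : ℕ} [Fact p.Prime] (n : ℕ) {u : ℚ_[p]ˣ} (hu : ‖(u : ℚ_[p])‖ = 1)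
    (s : Set (Fin n → ℚ_[p])) : padicHaar p n (u • s) = padicHaar p n s := by
  have h : u • {x : Fin n → ℚ_[p] | ∀ i, ‖x i‖ ≤ 1} = {x | ∀ i, ‖x i‖ ≤ 1} := by
    ext x
    rw [Set.mem_smul_set_iff_inv_smul_mem]
    simp [Units.smul_def, hu]
  rw [← distribHaarChar_mul (padicHaar p n) u s, distribHaarChar_eq_div (μ := padicHaar p n)
    (s := {x | ∀ i, ‖x i‖ ≤ 1})
    (by simp [padicHaar_unitBall]) (by simp [padicHaar_unitBall]), h, padicHaar_unitBall, div_one, one_mul]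

theorem Padic.norm_le_one_of_inv_smul_removeNth {p : ℕ} [Fact p.Prime] {n : ℕ} (i : Fin (n + 1))
    {x : Fin (n + 1) → ℚ_[p]} (h0 : x i ≠ 0) (h1 : ‖x i‖ ≤ 1)
    (hx : ∀ j, ‖((x i)⁻¹ • i.removeNth x) j‖ ≤ 1) (j : Fin (n + 1)) : ‖x j‖ ≤ 1 := by
  revert j
  rw [Fin.forall_iff_succAbove i]
  refine ⟨h1, fun j => ?_⟩
  have := hx j
  rw [Pi.smul_apply, smul_eq_mul, norm_mul, norm_inv,
    inv_mul_le_one₀ (norm_pos_iff.2 h0)] at this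
  exact this.trans h1

/-- Inserting an `i`-th coordinate, as an additive equivalence. -/
noncomputable def padicInsertNth (p : ℕ) [Fact p.Prime] {n : ℕ} (i : Fin (n + 1)) :
    (Fin 1 → ℚ_[p]) × (Fin n → ℚ_[p]) ≃+ (Fin (n + 1) → ℚ_[p]) where
  toFun y := Fin.insertNth (α := fun _ => ℚ_[p]) i (y.1 0) y.2
  invFun x := (fun _ => x i, i.removeNth x)
  left_inv y := by
    ext j
    · simp [Subsingleton.elim j 0]
    · simp
  right_inv x := by simp
  map_add' y z := by simp [← Fin.insertNth_add]

theorem continuous_padicInsertNth (p : ℕ) [Fact p.Prime] {n : ℕ} (i : Fin (n + 1)) :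
    Continuous (padicInsertNth p i) := by
  change Continuous fun y : (Fin 1 → ℚ_[p]) × (Fin n → ℚ_[p]) =>
    Fin.insertNth (α := fun _ => ℚ_[p]) i (y.1 0) y.2
  fun_prop

theorem map_padicInsertNth (p : ℕ) [Fact p.Prime] {n : ℕ} (i : Fin (n + 1)) :
    ((padicHaar p 1).prod (padicHaar p n)).map (padicInsertNth p i) = padicHaar p (n + 1) := by
  have hc := continuous_padicInsertNth p i
  have hc' : Continuous (padicInsertNth p i).symm := by
    change Continuous fun x : Fin (n + 1) → ℚ_[p] => ((fun _ => x i : Fin 1 → ℚ_[p]), i.removeNth x)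
    unfold Fin.removeNth
    fun_prop
  have := Measure.prod.instIsAddHaarMeasure (padicHaar p 1) (padicHaar p n)
  have := (padicInsertNth p i).isAddHaarMeasure_map ((padicHaar p 1).prod (padicHaar p n)) hc hc'
  rw [Measure.addHaarMeasure_unique (Measure.map _ _) (padicUnitPC p (n + 1))]
  have hpre : padicInsertNth p i ⁻¹' (padicUnitPC p (n + 1) : Set (Fin (n + 1) → ℚ_[p])) =
      {x | ∀ j, ‖x j‖ ≤ 1} ×ˢ {x | ∀ j, ‖x j‖ ≤ 1} := by
    ext y
    change (∀ j, ‖Fin.insertNth (α := fun _ => ℚ_[p]) i (y.1 0) y.2 j‖ ≤ 1) ↔ _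
    simp [Fin.forall_iff_succAbove i]
  rw [Measure.map_apply hc.measurable (padicUnitPC p (n + 1)).isCompact.measurableSet, hpre,
    Measure.prod_prod, padicHaar_unitBall, padicHaar_unitBall, one_mul, one_smul, padicHaar]

theorem padicHaar_unitSphere (p : ℕ) [Fact p.Prime] :
    padicHaar p 1 {s | ‖s 0‖ = 1} = 1 - (p : ENNReal)⁻¹ := by
  have h : {s : Fin 1 → ℚ_[p] | ‖s 0‖ = 1} = {s | ∀ i, ‖s i‖ ≤ 1} \ {s | ∀ i, ‖s i‖ < 1} := by
    ext s
    simp [Fin.forall_fin_one, le_antisymm_iff]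
  have ho : MeasurableSet {s : Fin 1 → ℚ_[p] | ∀ i, ‖s i‖ < 1} := by
    simp only [Fin.forall_fin_one]
    exact (isOpen_lt (by fun_prop) continuous_const).measurableSet
  have hsub : {s : Fin 1 → ℚ_[p] | ∀ i, ‖s i‖ < 1} ⊆ {s | ∀ i, ‖s i‖ ≤ 1} :=
    fun s hs i => (hs i).le
  rw [h, measure_sdiff hsub ho.nullMeasurableSet
    (measure_ne_top_of_subset hsub (by rw [padicHaar_unitBall]; exact ENNReal.one_ne_top)),
    padicHaar_unitBall,
    padicHaar_openUnitBall, pow_one]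

theorem measurableSet_norm_eq_one_inv_smul_removeNth {p : ℕ} [Fact p.Prime] {n : ℕ}
    (i : Fin (n + 1)) {M : Set (Fin n → ℚ_[p])} (hM : MeasurableSet M) :
    MeasurableSet {x : Fin (n + 1) → ℚ_[p] | ‖x i‖ = 1 ∧ (x i)⁻¹ • i.removeNth x ∈ M} := by
  set S : Set (Fin (n + 1) → ℚ_[p]) := {x | ‖x i‖ = 1} with hS
  have hSm : MeasurableSet S :=
    (isClosed_eq (by fun_prop) continuous_const).measurableSet
  have hc : ContinuousOn (fun x : Fin (n + 1) → ℚ_[p] => (x i)⁻¹ • i.removeNth x) S := by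
    refine ContinuousOn.smul (ContinuousOn.inv₀ (continuous_apply i).continuousOn fun x hx h0 => ?_) ?_
    · simp [hS, h0] at hx
    · unfold Fin.removeNth
      fun_prop
  convert hSm.subtype_image (hc.domRestrict.measurable hM) using 1
  ext x
  simp [hS, and_comm]

theorem padicHaar_norm_eq_one_inv_smul_removeNth {p : ℕ} [Fact p.Prime] {n : ℕ}
    (i : Fin (n + 1)) {M : Set (Fin n → ℚ_[p])} (hM : MeasurableSet M) :
    padicHaar p (n + 1) {x | ‖x i‖ = 1 ∧ (x i)⁻¹ • i.removeNth x ∈ M} =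
      (1 - (p : ENNReal)⁻¹) * padicHaar p n M := by
  have hW := measurableSet_norm_eq_one_inv_smul_removeNth i hM
  have hc := continuous_padicInsertNth p i
  rw [← map_padicInsertNth p i, Measure.map_apply hc.measurable hW,
    Measure.prod_apply (hc.measurable hW), ← padicHaar_unitSphere, mul_comm,
    ← lintegral_indicator_const
      (isClosed_eq (by fun_prop) continuous_const :
        IsClosed {s : Fin 1 → ℚ_[p] | ‖s 0‖ = 1}).measurableSet]
  refine lintegral_congr fun s => ?_
  have hpre : Prod.mk s ⁻¹' (padicInsertNth p i ⁻¹'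
      {x | ‖x i‖ = 1 ∧ (x i)⁻¹ • i.removeNth x ∈ M}) =
      {x | ‖s 0‖ = 1 ∧ (s 0)⁻¹ • x ∈ M} := by
    ext x
    simp [padicInsertNth]
  rw [hpre]
  by_cases hs : ‖s 0‖ = 1
  · have h0 : s 0 ≠ 0 := norm_ne_zero_iff.1 (by simp [hs])
    rw [Set.indicator_of_mem (by exact hs), ← padicHaar_unit_smul n (u := Units.mk0 (s 0) h0) hs M]
    congr 1
    ext x
    rw [Set.mem_smul_set_iff_inv_smul_mem]
    simp [hs, Units.smul_def]
  · rw [Set.indicator_of_notMem (by exact hs)]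
    simp [hs]

theorem padicHaar_norm_le_one_inv_smul_removeNth {p : ℕ} [Fact p.Prime] {n : ℕ}
    (i : Fin (n + 1)) {M : Set (Fin n → ℚ_[p])} (hM : MeasurableSet M)
    (hMsub : M ⊆ {x | ∀ j, ‖x j‖ ≤ 1}) :
    padicHaar p (n + 1) {x | x i ≠ 0 ∧ ‖x i‖ ≤ 1 ∧ (x i)⁻¹ • i.removeNth x ∈ M} =
      (((p : ENNReal) ^ (n + 1) - (p : ENNReal) ^ n) / ((p : ENNReal) ^ (n + 1) - 1)) *
        padicHaar p n M := by
  set T : Set (Fin (n + 1) → ℚ_[p]) :=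
    {x | x i ≠ 0 ∧ ‖x i‖ ≤ 1 ∧ (x i)⁻¹ • i.removeNth x ∈ M} with hT
  set W : Set (Fin (n + 1) → ℚ_[p]) := {x | ‖x i‖ = 1 ∧ (x i)⁻¹ • i.removeNth x ∈ M} with hW
  have hp1 : (1 : ENNReal) < p := mod_cast (Fact.out : p.Prime).one_lt
  have hp0 : (p : ENNReal) ≠ 0 := (zero_lt_one.trans hp1).ne'
  have hpt : (p : ENNReal) ≠ ⊤ := ENNReal.natCast_ne_top p
  have hpT : padicPUnit p • T = 
      {x : Fin (n + 1) → ℚ_[p] | x i ≠ 0 ∧ ‖x i‖ < 1 ∧ (x i)⁻¹ • i.removeNth x ∈ M} := by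
    ext x
    have hp : (p : ℚ_[p]) ≠ 0 := Nat.cast_ne_zero.2 (Fact.out : p.Prime).ne_zero
    have hr : i.removeNth ((p : ℚ_[p])⁻¹ • x) = (p : ℚ_[p])⁻¹ • i.removeNth x := rfl
    rw [Set.mem_smul_set_iff_inv_smul_mem]
    simp only [hT, Set.mem_ofPred_eq, Units.smul_def, padicPUnit, Units.val_inv_eq_inv_val,
      Units.val_mk0, Pi.smul_apply, smul_eq_mul, Padic.norm_inv_p_mul_le_one_iff, hr, smul_smul]
    rw [show ((p : ℚ_[p])⁻¹ * x i)⁻¹ * (p : ℚ_[p])⁻¹ = (x i)⁻¹ by field_simp]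
    simp [hp]
  have hTW : T = W ∪ padicPUnit p • T := by
    rw [hpT]
    ext x
    simp only [hT, hW, Set.mem_ofPred_eq, Set.mem_union, le_iff_eq_or_lt]
    have : ‖x i‖ = 1 → x i ≠ 0 := fun h => norm_ne_zero_iff.1 (by simp [h])
    tauto
  have hdisj : Disjoint (padicPUnit p • T) W := by
    rw [hpT, Set.disjoint_left]
    exact fun x hx hx' => hx.2.1.ne hx'.1
  have hTball : T ⊆ {x | ∀ j, ‖x j‖ ≤ 1} := by
    rintro x ⟨h0, h1, h2⟩
    exact Padic.norm_le_one_of_inv_smul_removeNth i h0 h1 (hMsub h2)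
  have hTt : padicHaar p (n + 1) T ≠ ⊤ :=
    measure_ne_top_of_subset hTball (by simp [padicHaar_unitBall])
  have hrec : padicHaar p (n + 1) T = (1 - (p : ENNReal)⁻¹) * padicHaar p n M +
      ((p : ENNReal) ^ (n + 1))⁻¹ * padicHaar p (n + 1) T := by
    conv_lhs => rw [hTW, Set.union_comm, measure_union hdisj
      (measurableSet_norm_eq_one_inv_smul_removeNth i hM),
      padicHaar_norm_eq_one_inv_smul_removeNth i hM, padicHaar_p_smul, add_comm]
  set t := padicHaar p (n + 1) T
  set b := padicHaar p n M
  have hmul : (p : ENNReal) ^ (n + 1) * t =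
      ((p : ENNReal) ^ (n + 1) - (p : ENNReal) ^ n) * b + t := by
    conv_lhs => rw [hrec]
    rw [mul_add, ← mul_assoc, ← mul_assoc, ENNReal.mul_inv_cancel (pow_ne_zero _ hp0)
      (ENNReal.pow_ne_top hpt), one_mul, ENNReal.mul_sub (fun _ _ => ENNReal.pow_ne_top hpt),
      mul_one, pow_succ, mul_assoc, ENNReal.mul_inv_cancel hp0 hpt, mul_one]
  have hlt : (1 : ENNReal) < (p : ENNReal) ^ (n + 1) := one_lt_pow₀ hp1 n.succ_ne_zero
  rw [mul_comm, ← mul_div_assoc, mul_comm b, ENNReal.eq_div_iff (tsub_pos_of_lt hlt).ne'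
    (ENNReal.sub_ne_top (ENNReal.pow_ne_top hpt)), ENNReal.sub_mul (fun _ _ => hTt), one_mul, hmul,
    ENNReal.add_sub_cancel_right hTt]

/-- the measure of `φ(η_i(M))` for Borel `M ⊆ ℤ_p^{n-1}`. -/
theorem eta_measure (n p : ℕ) (hn : 1 ≤ n) [Fact p.Prime] (i : Fin (n + 1))
    (M : Set (Fin n → ℚ_[p])) (hM : MeasurableSet M)
    (hMsub : M ⊆ {x | ∀ j, ‖x j‖ ≤ 1}) :
    muP p (n + 1) {z | ∃ x ∈ M, ∃ h : Fin.insertNth (α := fun _ => ℚ_[p]) i 1 x ≠ 0,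
        z = Projectivization.mk ℚ_[p] (Fin.insertNth (α := fun _ => ℚ_[p]) i 1 x) h} =
      (((p : ENNReal) ^ (n + 1) - (p : ENNReal) ^ n) / ((p : ENNReal) ^ (n + 1) - 1)) *
        padicHaar p n M := by
  rw [← padicHaar_norm_le_one_inv_smul_removeNth i hM hMsub, muP]
  congr 1
  ext x
  simp only [Set.mem_ofPred_eq, Projectivization.mk_eq_mk_iff']
  constructor
  · rintro ⟨hx, hx0, y, hy, -, a, rfl⟩
    have ha : a ≠ 0 := by
      rintro rfl
      simp at hx0
    have hr : i.removeNth (a • Fin.insertNth (α := fun _ => ℚ_[p]) i 1 y) = a • y := by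
      ext j
      simp [Fin.removeNth]
    exact ⟨by simpa using ha, hx i, by simpa [hr, smul_smul, ha] using hy⟩
  · rintro ⟨h0, h1, h2⟩
    refine ⟨Padic.norm_le_one_of_inv_smul_removeNth i h0 h1 (hMsub h2),
      fun h => h0 (by simp [h]), _, h2, fun h => ?_, x i, ?_⟩
    · simpa using congrFun h i
    · ext j
      refine Fin.succAboveCases i ?_ (fun k => ?_) j
      · simp
      · simp [Fin.removeNth, h0]
end

section
/- Let n ≥ 3, let p be a prime, let q ≥ 1 be an integer with p ∤ q, and let k ≥ 1 be an integer with p^{-k} ≤ 1/q. Define A_{q,n} := ⋃ B_δ(φ(y), p^{-k}), the union over all y ∈ ℤ^n_vis with y_n = q and |y_j| ≤ q for all j. Then there exist constants c₂ ≥ c₁ > 0, depending only on n, such that c₁·q^{n-1}·p^{-k(n-1)} ≤ μ_p(A_{q,n}) ≤ c₂·q^{n-1}·p^{-k(n-1)}. -/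
open MeasureTheory

lemma card_piFinset_ite_eq {n : ℕ} (l : Fin n) (c : ℤ) (s : Finset ℤ) :
    (Fintype.piFinset fun j : Fin n => if j = l then {c} else s).card = s.card ^ (n - 1) := by
  rw [Fintype.card_piFinset, ← Finset.mul_prod_erase _ _ (Finset.mem_univ l)]
  rw [Finset.prod_congr rfl (g := fun _ => s.card)]
  · simp
  · intro j hj
    simp [Finset.ne_of_mem_erase hj]

lemma sum_Icc_two_inv_sq_le (q : ℕ) :
    ∑ d ∈ Finset.Icc 2 q, (1 : ℝ) / (d : ℝ) ^ 2 ≤ 3 / 4 := by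
  rcases Nat.lt_or_ge q 2 with h | h
  · rw [Finset.Icc_eq_empty (by omega)]; norm_num
  · have : ∑ d ∈ Finset.Icc 2 q, (1 : ℝ) / (d : ℝ) ^ 2 ≤ 3 / 4 - 1 / q := by
      induction q, h using Nat.le_induction with
      | base => norm_num
      | succ m hm ih =>
        rw [Finset.sum_Icc_succ_top (by omega)]
        have hm' : (0 : ℝ) < m := by positivity
        have : (1 : ℝ) / ((m + 1 : ℕ) : ℝ) ^ 2 ≤ 1 / m - 1 / ((m + 1 : ℕ) : ℝ) := by
          push_cast
          rw [div_sub_div _ _ hm'.ne' (by positivity), div_le_div_iff₀ (by positivity) (by positivity)]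
          nlinarith
        linarith
    have h0 : (0 : ℝ) ≤ 1 / q := by positivity
    linarith

/-- At least a quarter of the integer vectors with `l`-th entry `q` and the other entries in
`[1, q]` are primitive. -/
lemma card_isPrim_ge {n : ℕ} (hn : 3 ≤ n) (l : Fin n) (q : ℕ) (hq : 1 ≤ q)
    [DecidablePred (@IsPrim n)] :
    (1 / 4 : ℝ) * (q : ℝ) ^ (n - 1) ≤
      (((Fintype.piFinset fun j : Fin n => if j = l then {(q : ℤ)} else Finset.Icc 1 (q : ℤ)).filter
        IsPrim).card : ℝ) := by
  set S := Fintype.piFinset fun j : Fin n => if j = l then {(q : ℤ)} else Finset.Icc 1 (q : ℤ)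
    with hS
  set M : ℕ → Finset (Fin n → ℤ) := fun d => Fintype.piFinset fun j : Fin n =>
    if j = l then {(q : ℤ)} else (Finset.Ioc 0 (q : ℤ)).filter fun x => (d : ℤ) ∣ x with hM
  have hSc : S.card = q ^ (n - 1) := by
    rw [hS, card_piFinset_ite_eq, Int.card_Icc]; simp
  have hsub : S.filter (fun v => ¬ IsPrim v) ⊆ (Finset.Icc 2 q).biUnion M := by
    intro v hv
    rw [Finset.mem_filter, hS, Fintype.mem_piFinset] at hv
    obtain ⟨hv, hp⟩ := hv
    have hl : v l = q := by simpa using hv l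
    have hdvd : ∀ j, Finset.univ.gcd v ∣ v j := fun j => Finset.gcd_dvd (Finset.mem_univ j)
    have hnn : 0 ≤ Finset.univ.gcd v := by
      rw [← Finset.normalize_gcd]; exact Int.nonneg_of_normalize_eq_self (by simp)
    obtain ⟨d, hd⟩ := Int.eq_ofNat_of_zero_le hnn
    rw [hd] at hdvd
    have hdq : d ∣ q := by have := hdvd l; rw [hl] at this; exact_mod_cast this
    have hd1 : d ≠ 1 := by
      rintro rfl; exact hp (by simpa [IsPrim] using hd)
    have hd0 : 0 < d := Nat.pos_of_dvd_of_pos hdq hq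
    have hdle := Nat.le_of_dvd hq hdq
    refine Finset.mem_biUnion.2 ⟨d, Finset.mem_Icc.2 ⟨by omega, hdle⟩, ?_⟩
    rw [hM, Fintype.mem_piFinset]
    intro j
    by_cases hj : j = l
    · subst hj; simp [hl]
    · have := hv j
      simp only [hj, if_false, Finset.mem_Icc] at this
      simp only [hj, if_false, Finset.mem_filter, Finset.mem_Ioc]
      exact ⟨⟨by omega, this.2⟩, hdvd j⟩
  have hMc : ∀ d ∈ Finset.Icc 2 q, ((M d).card : ℝ) ≤ (q : ℝ) ^ (n - 1) * (1 / (d : ℝ) ^ 2) := by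
    intro d hd
    have hd2 := (Finset.mem_Icc.1 hd).1
    have hdpos : (0 : ℝ) < d := by positivity
    have h1 : ((Finset.Ioc 0 (q : ℤ)).filter fun x => (d : ℤ) ∣ x).card = q / d := by
      rw [← Int.natCast_inj, Int.Ioc_filter_dvd_card _ _ (by positivity)]
      have : ⌊((q : ℤ) : ℚ) / ((d : ℤ) : ℚ)⌋ = ((q / d : ℕ) : ℤ) := by
        simpa using Rat.floor_intCast_div_natCast q d
      rw [this]
      simp only [Int.cast_zero, zero_div, Int.floor_zero, sub_zero]
      exact max_eq_left (Int.natCast_nonneg _)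
    rw [hM, card_piFinset_ite_eq, h1]
    push_cast
    calc ((q / d : ℕ) : ℝ) ^ (n - 1) ≤ ((q : ℝ) / d) ^ (n - 1) := by
          gcongr; exact Nat.cast_div_le
      _ = (q : ℝ) ^ (n - 1) * (1 / (d : ℝ) ^ (n - 1)) := by rw [div_pow]; ring
      _ ≤ _ := by
          gcongr
          · exact_mod_cast (by omega : 1 ≤ d)
          · omega
  have hbad : ((S.filter (fun v => ¬ IsPrim v)).card : ℝ) ≤ (q : ℝ) ^ (n - 1) * (3 / 4) := by
    calc ((S.filter (fun v => ¬ IsPrim v)).card : ℝ)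
        ≤ (((Finset.Icc 2 q).biUnion M).card : ℝ) := by exact_mod_cast Finset.card_le_card hsub
      _ ≤ ∑ d ∈ Finset.Icc 2 q, ((M d).card : ℝ) := by exact_mod_cast Finset.card_biUnion_le
      _ ≤ ∑ d ∈ Finset.Icc 2 q, (q : ℝ) ^ (n - 1) * (1 / (d : ℝ) ^ 2) := Finset.sum_le_sum hMc
      _ ≤ _ := by rw [← Finset.mul_sum]; gcongr; exact sum_Icc_two_inv_sq_le q
  have hsplit := Finset.card_filter_add_card_filter_not (s := S) (fun v => IsPrim v)
  have hsplit' : ((S.filter IsPrim).card : ℝ) + ((S.filter (fun v => ¬ IsPrim v)).card : ℝ)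
      = (q : ℝ) ^ (n - 1) := by rw [hSc] at hsplit; exact_mod_cast hsplit
  linarith

lemma padicDelta_smul_left (p : ℕ) [Fact p.Prime] {n : ℕ} (c : ℚ_[p]) (hc : c ≠ 0)
    (x y : Fin n → ℚ_[p]) : padicDelta p (c • x) y = padicDelta p x y := by
  have hc' : ‖c‖ ≠ 0 := norm_ne_zero_iff.2 hc
  unfold padicDelta
  have : ∀ ij : Fin n × Fin n, ‖(c • x) ij.1 * y ij.2 - (c • x) ij.2 * y ij.1‖
      = ‖c‖ * ‖x ij.1 * y ij.2 - x ij.2 * y ij.1‖ := by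
    intro ij
    rw [← norm_mul]; congr 1; simp only [Pi.smul_apply, smul_eq_mul]; ring
  simp_rw [this]
  rw [← Real.mul_iSup_of_nonneg (norm_nonneg _), norm_smul, mul_assoc, mul_div_mul_left _ _ hc']

lemma mk_mem_Bdelta_iff (p : ℕ) [Fact p.Prime] {n : ℕ} (x y : Fin n → ℚ_[p]) (hx : x ≠ 0)
    (r : ℝ) : Projectivization.mk ℚ_[p] x hx ∈ Bdelta p y r ↔ padicDelta p x y ≤ r := by
  obtain ⟨a, ha⟩ := Projectivization.exists_smul_eq_mk_rep ℚ_[p] x hx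
  rw [Bdelta, Set.mem_ofPred_eq, ← ha, Units.smul_def, padicDelta_smul_left _ _ a.ne_zero]

/-- The integral vectors `x` such that `v l • x` is congruent to `x l • v` up to `r`. -/
def coneGroup (p : ℕ) [Fact p.Prime] {n : ℕ} (l : Fin n) (v : Fin n → ℤ) (r : ℝ) :
    Set (Fin n → ℚ_[p]) :=
  {x | (∀ i, ‖x i‖ ≤ 1) ∧ ∀ j, ‖(v l : ℚ_[p]) * x j - x l * v j‖ ≤ r}

/-- The elements of `coneGroup` whose `l`-th coordinate is a unit. -/
def coneUnits (p : ℕ) [Fact p.Prime] {n : ℕ} (l : Fin n) (v : Fin n → ℤ) (r : ℝ) :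
    Set (Fin n → ℚ_[p]) :=
  {x | x ∈ coneGroup p l v r ∧ ‖x l‖ = 1}

section Cone

variable (p : ℕ) [Fact p.Prime] {n : ℕ} (l : Fin n) (v : Fin n → ℤ)

lemma isClosed_coneGroup (r : ℝ) : IsClosed (coneGroup p l v r) := by
  unfold coneGroup
  simp only [Set.ofPred_and, Set.ofPred_forall]
  refine IsClosed.inter (isClosed_iInter fun i => ?_) (isClosed_iInter fun i => ?_)
  · exact isClosed_le (by fun_prop) (by fun_prop)
  · exact isClosed_le (by fun_prop) (by fun_prop)

lemma isClosed_coneUnits (r : ℝ) : IsClosed (coneUnits p l v r) :=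
  (isClosed_coneGroup p l v r).inter (isClosed_eq (by fun_prop) (by fun_prop))

lemma padicHaar_unit : padicHaar p n {x | ∀ i, ‖x i‖ ≤ 1} = 1 :=
  Measure.addHaarMeasure_self (K₀ := padicUnitPC p n)

instance : (padicHaar p n).IsAddHaarMeasure :=
  Measure.isAddHaarMeasure_addHaarMeasure _

variable {p l v}

lemma Padic.norm_sub_le_max (x y : ℚ_[p]) : ‖x - y‖ ≤ max ‖x‖ ‖y‖ := by
  simpa [sub_eq_add_neg] using Padic.nonarchimedean x (-y)

lemma Padic.exists_nat_lt_norm_sub_le (z : ℚ_[p]) (hz : ‖z‖ ≤ 1) (k : ℕ) :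
    ∃ a : ℕ, a < p ^ k ∧ ‖z - a‖ ≤ (p : ℝ) ^ (-(k : ℤ)) := by
  let x : ℤ_[p] := ⟨z, hz⟩
  refine ⟨PadicInt.appr x k, PadicInt.appr_lt _ _, ?_⟩
  have := (PadicInt.norm_le_pow_iff_mem_span_pow _ k).2 (PadicInt.appr_spec k x)
  simpa [PadicInt.norm_def] using this

lemma padicHaar_coneGroup (hv : ‖(v l : ℚ_[p])‖ = 1) (k : ℕ) :
    padicHaar p n (coneGroup p l v ((p : ℝ) ^ (-(k : ℤ)))) * ((p ^ k) ^ (n - 1) : ℕ) = 1 := by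
  set D := coneGroup p l v ((p : ℝ) ^ (-(k : ℤ))) with hD
  set S := Fintype.piFinset fun j : Fin n => if j = l then {0} else Finset.Ico 0 ((p : ℤ) ^ k)
    with hS
  have hv0 : (v l : ℚ_[p]) ≠ 0 := by rw [← norm_ne_zero_iff, hv]; simp
  have hSc : S.card = (p ^ k) ^ (n - 1) := by
    rw [hS, card_piFinset_ite_eq]; congr 1
    rw [Int.card_Ico, sub_zero]
    exact_mod_cast Int.toNat_natCast (p ^ k)
  have hSl : ∀ a ∈ S, a l = 0 := by
    intro a ha
    simpa using Fintype.mem_piFinset.1 ha l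
  have hSj : ∀ a ∈ S, ∀ j, 0 ≤ a j ∧ a j < (p : ℤ) ^ k := by
    intro a ha j
    by_cases hj : j = l
    · have : (0 : ℤ) < (p : ℤ) ^ k := by
        have := (Fact.out : p.Prime).pos
        positivity
      rw [hj, hSl a ha]; exact ⟨le_rfl, this⟩
    · simpa [hj] using Fintype.mem_piFinset.1 ha j
  have hunion : {x : Fin n → ℚ_[p] | ∀ i, ‖x i‖ ≤ 1} =
      ⋃ a ∈ S, (fun x => -intPadic p a + x) ⁻¹' D := by
    ext x
    simp only [Set.mem_ofPred_eq, Set.mem_iUnion, Set.mem_preimage, exists_prop]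
    constructor
    · intro hx
      have hz : ∀ j, ‖x j - x l * v j / v l‖ ≤ 1 := by
        intro j
        refine (Padic.norm_sub_le_max _ _).trans (max_le (hx j) ?_)
        rw [norm_div, hv, norm_mul, div_one]
        exact mul_le_one₀ (hx l) (norm_nonneg _) (Padic.norm_int_le_one _)
      choose a ha ha' using fun j => Padic.exists_nat_lt_norm_sub_le _ (hz j) k
      refine ⟨fun j => if j = l then 0 else (a j : ℤ), ?_, ?_, ?_⟩
      · rw [hS, Fintype.mem_piFinset]
        intro j
        by_cases hj : j = l
        · simp [hj]
        · simp [hj]; exact_mod_cast ha j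
      · intro i
        rw [Pi.add_apply, Pi.neg_apply, neg_add_eq_sub]
        exact (Padic.norm_sub_le_max _ _).trans (max_le (hx i) (Padic.norm_int_le_one _))
      · intro j
        by_cases hj : j = l
        · subst hj
          simp only [mul_comm, sub_self, norm_zero]; positivity
        · have : (v l : ℚ_[p]) * (-(a j : ℚ_[p]) + x j) - x l * v j
              = v l * (x j - x l * v j / v l - a j) := by field_simp; ring
          simp only [intPadic, Pi.add_apply, Pi.neg_apply, hj, if_true, if_false, Int.cast_zero,
            neg_zero, zero_add, Int.cast_natCast]
          rw [this, norm_mul, hv, one_mul]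
          exact ha' j
    · rintro ⟨a, ha, hx, -⟩ i
      have := hx i
      have e : x i = (-intPadic p a + x) i - ((-a i : ℤ) : ℚ_[p]) := by simp [intPadic]
      rw [e]
      exact (Padic.norm_sub_le_max _ _).trans (max_le this (Padic.norm_int_le_one _))
  have hdisj : (S : Set (Fin n → ℤ)).PairwiseDisjoint
      fun a => (fun x => -intPadic p a + x) ⁻¹' D := by
    intro a ha b hb hab
    refine Set.disjoint_left.2 fun x hxa hxb => hab ?_
    funext j
    have h1 := hxa.2 j
    have h2 := hxb.2 j
    simp only [intPadic, Pi.add_apply, Pi.neg_apply, hSl a ha, hSl b hb] at h1 h2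
    have h3 : ‖((a j - b j : ℤ) : ℚ_[p])‖ ≤ (p : ℝ) ^ (-(k : ℤ)) := by
      rw [← one_mul ‖_‖, ← hv, ← norm_mul]
      refine le_trans (le_of_eq ?_) ((Padic.norm_sub_le_max _ _).trans (max_le h2 h1))
      congr 1; push_cast; ring
    rw [Padic.norm_int_le_pow_iff_dvd] at h3
    have := hSj a ha j
    have := hSj b hb j
    have := Int.eq_zero_of_abs_lt_dvd h3 (abs_lt.2 ⟨by omega, by omega⟩)
    omega
  have hmeas := measure_biUnion_finset (μ := padicHaar p n) hdisj fun a _ =>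
    ((isClosed_coneGroup p l v _).preimage (continuous_const.add continuous_id)).measurableSet
  rw [← hunion, padicHaar_unit] at hmeas
  simp only [measure_preimage_add, Finset.sum_const, nsmul_eq_mul, hSc] at hmeas
  rw [hmeas, mul_comm]

lemma padicHaar_coneGroup_toReal (hv : ‖(v l : ℚ_[p])‖ = 1) (k : ℕ) :
    (padicHaar p n).real (coneGroup p l v ((p : ℝ) ^ (-(k : ℤ))))
      = (((p : ℝ) ^ k) ^ (n - 1))⁻¹ := by
  have := congrArg ENNReal.toReal (padicHaar_coneGroup hv k)
  rw [ENNReal.toReal_mul] at this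
  refine eq_inv_of_mul_eq_one_left ?_
  simpa [Measure.real] using this

lemma measure_subset_unit_ne_top {s : Set (Fin n → ℚ_[p])} (hs : s ⊆ {x | ∀ i, ‖x i‖ ≤ 1}) :
    padicHaar p n s ≠ ⊤ :=
  measure_ne_top_of_subset hs (by rw [padicHaar_unit]; simp)

lemma padicHaar_coneUnits_ge (hv : ‖(v l : ℚ_[p])‖ = 1) (k : ℕ) :
    (1 / 2 : ℝ) * (((p : ℝ) ^ k) ^ (n - 1))⁻¹ ≤
      (padicHaar p n).real (coneUnits p l v ((p : ℝ) ^ (-(k : ℤ)))) := by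
  set r := (p : ℝ) ^ (-(k : ℤ))
  have hE : padicHaar p n (coneUnits p l v r) ≠ ⊤ :=
    measure_subset_unit_ne_top fun x hx => hx.1.1
  have hsub : coneGroup p l v r ⊆
      coneUnits p l v r ∪ (fun x => intPadic p v + x) ⁻¹' coneUnits p l v r := by
    intro x hx
    rcases (hx.1 l).lt_or_eq with h | h
    · right
      refine ⟨⟨fun i => ?_, fun j => ?_⟩, ?_⟩
      · exact (Padic.nonarchimedean _ _).trans (max_le (Padic.norm_int_le_one _) (hx.1 i))
      · refine le_trans (le_of_eq ?_) (hx.2 j)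
        congr 1; simp only [intPadic, Pi.add_apply]; ring
      · simp only [intPadic, Pi.add_apply]
        rw [Padic.add_eq_max_of_ne (by rw [hv]; exact h.ne'), hv, max_eq_left h.le]
    · exact Or.inl ⟨hx, h⟩
  have h := (measure_mono hsub).trans (measure_union_le (μ := padicHaar p n) _ _)
  rw [measure_preimage_add] at h
  have h' := ENNReal.toReal_mono (ENNReal.add_ne_top.2 ⟨hE, hE⟩) h
  rw [ENNReal.toReal_add hE hE] at h'
  have h3 := padicHaar_coneGroup_toReal hv k
  simp only [Measure.real] at h3 ⊢
  linarith

lemma norm_intPadic_eq_one (hv : ‖(v l : ℚ_[p])‖ = 1) : ‖intPadic p v‖ = 1 := by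
  refine le_antisymm ((pi_norm_le_iff_of_nonneg zero_le_one).2 fun i => Padic.norm_int_le_one _) ?_
  rw [← hv]; exact norm_le_pi_norm (intPadic p v) l

lemma mem_coneGroup_of_padicDelta_le (hv : ‖(v l : ℚ_[p])‖ = 1) {r : ℝ} (hr : 0 ≤ r)
    {x : Fin n → ℚ_[p]} (hx0 : x ≠ 0) (hx : ∀ i, ‖x i‖ ≤ 1)
    (h : padicDelta p x (intPadic p v) ≤ r) : x ∈ coneGroup p l v r := by
  refine ⟨hx, fun j => ?_⟩
  rw [padicDelta, norm_intPadic_eq_one hv, mul_one, div_le_iff₀ (norm_pos_iff.2 hx0)] at h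
  have h1 := (le_ciSup (Set.finite_range fun ij : Fin n × Fin n =>
    ‖x ij.1 * intPadic p v ij.2 - x ij.2 * intPadic p v ij.1‖).bddAbove (j, l)).trans h
  simp only [intPadic] at h1
  rw [mul_comm (v l : ℚ_[p])]
  exact h1.trans (mul_le_of_le_one_right hr ((pi_norm_le_iff_of_nonneg zero_le_one).2 hx))

lemma padicDelta_le_of_mem_coneUnits (hv : ‖(v l : ℚ_[p])‖ = 1) {r : ℝ} (hr : 0 ≤ r)
    {x : Fin n → ℚ_[p]} (hx : x ∈ coneUnits p l v r) : padicDelta p x (intPadic p v) ≤ r := by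
  have hnx : ‖x‖ = 1 := le_antisymm ((pi_norm_le_iff_of_nonneg zero_le_one).2 hx.1.1)
    (by rw [← hx.2]; exact norm_le_pi_norm x l)
  rw [padicDelta, norm_intPadic_eq_one hv, hnx, mul_one, div_one]
  refine Real.iSup_le (fun ij => ?_) hr
  have key : ∀ i j, ‖((v l : ℚ_[p]) * x i - x l * v i) * v j‖ ≤ r := by
    intro i j
    rw [norm_mul]
    exact (mul_le_of_le_one_right (norm_nonneg _) (Padic.norm_int_le_one _)).trans (hx.1.2 i)
  rw [← one_mul ‖_‖, ← hv, ← norm_mul]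
  refine le_trans (le_of_eq ?_) ((Padic.norm_sub_le_max _ _).trans
    (max_le (key ij.1 ij.2) (key ij.2 ij.1)))
  congr 1; simp only [intPadic]; ring

lemma disjoint_coneUnits {q k : ℕ} (hqk : q ≤ p ^ k)
    {v w : Fin n → ℤ} (hvl : v l = q) (hwl : w l = q) (hv : ∀ j, 1 ≤ v j ∧ v j ≤ q)
    (hw : ∀ j, 1 ≤ w j ∧ w j ≤ q) (hvw : v ≠ w) :
    Disjoint (coneUnits p l v ((p : ℝ) ^ (-(k : ℤ))))
      (coneUnits p l w ((p : ℝ) ^ (-(k : ℤ)))) := by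
  refine Set.disjoint_left.2 fun x hxv hxw => hvw ?_
  funext j
  have h1 := hxv.1.2 j
  have h2 := hxw.1.2 j
  have h3 : ‖((v j - w j : ℤ) : ℚ_[p])‖ ≤ (p : ℝ) ^ (-(k : ℤ)) := by
    rw [← one_mul ‖_‖, ← hxv.2, ← norm_mul]
    refine le_trans (le_of_eq ?_) ((Padic.norm_sub_le_max _ _).trans (max_le h2 h1))
    congr 1; rw [hvl, hwl]; push_cast; ring
  rw [Padic.norm_int_le_pow_iff_dvd] at h3
  have := hv j
  have := hw j
  have hqk' : (q : ℤ) ≤ (p : ℤ) ^ k := by exact_mod_cast hqk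
  have := Int.eq_zero_of_abs_lt_dvd h3 (abs_lt.2 ⟨by omega, by omega⟩)
  omega

end Cone

/-- the measure of `A_{q,n}`, the union of projective balls of radius
`p^{-k} ≤ 1/q` around rational points of height `y_n = q`, is `≍ q^{n-1} p^{-k(n-1)}`. -/
theorem A_qn_measure (n : ℕ) (hn : 3 ≤ n) :
    ∃ c₁ c₂ : ℝ, 0 < c₁ ∧ c₁ ≤ c₂ ∧
      ∀ (p : ℕ) [Fact p.Prime], ∀ (q k : ℕ), 1 ≤ q → ¬ p ∣ q → 1 ≤ k →
        (p : ℝ) ^ (-(k : ℤ)) ≤ 1 / (q : ℝ) →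
        c₁ * (q : ℝ) ^ (n - 1) * (p : ℝ) ^ (-(k : ℤ) * (n - 1)) ≤
          (muP p n (⋃ v ∈ {v : Fin n → ℤ | IsPrim v ∧ v ⟨n - 1, by omega⟩ = (q : ℤ) ∧
              ∀ j, |v j| ≤ (q : ℤ)}, Bdelta p (intPadic p v) ((p : ℝ) ^ (-(k : ℤ))))).toReal ∧
        (muP p n (⋃ v ∈ {v : Fin n → ℤ | IsPrim v ∧ v ⟨n - 1, by omega⟩ = (q : ℤ) ∧
              ∀ j, |v j| ≤ (q : ℤ)}, Bdelta p (intPadic p v) ((p : ℝ) ^ (-(k : ℤ))))).toReal ≤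
          c₂ * (q : ℝ) ^ (n - 1) * (p : ℝ) ^ (-(k : ℤ) * (n - 1)) := by
  classical
  refine ⟨1 / 8, 3 ^ (n - 1), by norm_num, ?_, ?_⟩
  · exact le_trans (by norm_num) (one_le_pow₀ (by norm_num : (1 : ℝ) ≤ 3))
  intro p hp q k hq hpq hk hqk
  set l : Fin n := ⟨n - 1, by omega⟩
  set r : ℝ := (p : ℝ) ^ (-(k : ℤ)) with hr
  have hp0 : (0 : ℝ) < p := by exact_mod_cast hp.out.pos
  have hr0 : 0 ≤ r := by positivity
  have hqn : ‖((q : ℤ) : ℚ_[p])‖ = 1 := by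
    rw [Int.cast_natCast, Padic.norm_natCast_eq_one_iff]
    exact (Nat.Prime.coprime_iff_not_dvd hp.out).2 hpq
  have hqk' : q ≤ p ^ k := by
    rw [hr, zpow_neg, zpow_natCast, inv_eq_one_div,
      one_div_le_one_div (by positivity) (by exact_mod_cast hq)] at hqk
    exact_mod_cast hqk
  have hexp : (p : ℝ) ^ (-(k : ℤ) * (n - 1)) = (((p : ℝ) ^ k) ^ (n - 1))⁻¹ := by
    rw [← pow_mul, ← zpow_natCast, ← zpow_neg]
    congr 1
    push_cast [Nat.cast_sub (show 1 ≤ n by omega)]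
    ring
  rw [hexp]
  set X := {x : Fin n → ℚ_[p] | (∀ i, ‖x i‖ ≤ 1) ∧ ∃ hx : x ≠ 0, Projectivization.mk ℚ_[p] x hx ∈
    ⋃ v ∈ {v : Fin n → ℤ | IsPrim v ∧ v l = (q : ℤ) ∧ ∀ j, |v j| ≤ (q : ℤ)},
      Bdelta p (intPadic p v) r} with hX
  have hXtop : padicHaar p n X ≠ ⊤ := measure_subset_unit_ne_top fun x hx => hx.1
  change _ ≤ (padicHaar p n).real X ∧ (padicHaar p n).real X ≤ _
  constructor
  · set T := (Fintype.piFinset fun j : Fin n =>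
      if j = l then {(q : ℤ)} else Finset.Icc 1 (q : ℤ)).filter IsPrim with hT
    have hTl : ∀ v ∈ T, v l = q := fun v hv => by
      simpa using Fintype.mem_piFinset.1 (Finset.mem_filter.1 hv).1 l
    have hTj : ∀ v ∈ T, ∀ j, 1 ≤ v j ∧ v j ≤ q := fun v hv j => by
      by_cases hj : j = l
      · rw [hj, hTl v hv]; omega
      · simpa [hj] using Fintype.mem_piFinset.1 (Finset.mem_filter.1 hv).1 j
    have hsub : (⋃ v ∈ T, coneUnits p l v r) ⊆ X := by
      intro x hx
      simp only [Set.mem_iUnion, exists_prop] at hx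
      obtain ⟨v, hv, hx⟩ := hx
      have hx0 : x ≠ 0 := by
        rintro rfl; simpa using hx.2
      refine ⟨hx.1.1, hx0, Set.mem_biUnion (x := v) ⟨(Finset.mem_filter.1 hv).2, hTl v hv, ?_⟩
        ((mk_mem_Bdelta_iff p x _ hx0 r).2
          (padicDelta_le_of_mem_coneUnits (by rw [hTl v hv, hqn]) hr0 hx))⟩
      intro j
      have := hTj v hv j
      rw [abs_le]; omega
    have hU : (padicHaar p n).real (⋃ v ∈ T, coneUnits p l v r)
        = ∑ v ∈ T, (padicHaar p n).real (coneUnits p l v r) :=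
      measureReal_biUnion_finset
        (fun v hv w hw hvw => disjoint_coneUnits hqk' (hTl v hv) (hTl w hw) (hTj v hv)
          (hTj w hw) hvw)
        (fun v _ => (isClosed_coneUnits p l v r).measurableSet)
        (fun v _ => measure_subset_unit_ne_top fun x hx => hx.1.1)
    have hcard := card_isPrim_ge hn l q hq
    calc (1 / 8 : ℝ) * (q : ℝ) ^ (n - 1) * (((p : ℝ) ^ k) ^ (n - 1))⁻¹
        = ((1 / 4 : ℝ) * (q : ℝ) ^ (n - 1)) * ((1 / 2) * (((p : ℝ) ^ k) ^ (n - 1))⁻¹) := by ring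
      _ ≤ (T.card : ℝ) * ((1 / 2) * (((p : ℝ) ^ k) ^ (n - 1))⁻¹) := by gcongr
      _ = ∑ v ∈ T, (1 / 2 : ℝ) * (((p : ℝ) ^ k) ^ (n - 1))⁻¹ := by
          rw [Finset.sum_const, nsmul_eq_mul]
      _ ≤ ∑ v ∈ T, (padicHaar p n).real (coneUnits p l v r) :=
          Finset.sum_le_sum fun v hv => padicHaar_coneUnits_ge (by rw [hTl v hv, hqn]) k
      _ ≤ (padicHaar p n).real X := hU ▸ measureReal_mono hsub hXtop
  · set T := Fintype.piFinset fun j : Fin n =>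
      if j = l then {(q : ℤ)} else Finset.Icc (-q : ℤ) (q : ℤ) with hT
    have hTl : ∀ v ∈ T, v l = q := fun v hv => by
      simpa using Fintype.mem_piFinset.1 hv l
    have hsub : X ⊆ ⋃ v ∈ T, coneGroup p l v r := by
      rintro x ⟨hx, hx0, hmem⟩
      simp only [Set.mem_iUnion, exists_prop] at hmem
      obtain ⟨v, ⟨-, hvl, hvj⟩, hv⟩ := hmem
      refine Set.mem_biUnion (x := v) ?_ (mem_coneGroup_of_padicDelta_le (by rw [hvl, hqn]) hr0 hx0
        hx ((mk_mem_Bdelta_iff p x _ hx0 r).1 hv))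
      refine Fintype.mem_piFinset.2 fun j => ?_
      by_cases hj : j = l
      · simp [hj, hvl]
      · simpa [hj] using abs_le.1 (hvj j)
    have hcard : (T.card : ℝ) ≤ (3 * (q : ℝ)) ^ (n - 1) := by
      rw [hT, card_piFinset_ite_eq, Int.card_Icc]
      push_cast
      gcongr
      have : ((q : ℤ) + 1 - -(q : ℤ)).toNat ≤ 3 * q := by omega
      exact_mod_cast this
    calc (padicHaar p n).real X ≤ (padicHaar p n).real (⋃ v ∈ T, coneGroup p l v r) :=
          measureReal_mono hsub (measure_subset_unit_ne_top (Set.iUnion₂_subset fun v _ x hx => hx.1))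
      _ ≤ ∑ v ∈ T, (padicHaar p n).real (coneGroup p l v r) :=
          measureReal_biUnion_finset_le _ _
      _ = ∑ v ∈ T, (((p : ℝ) ^ k) ^ (n - 1))⁻¹ :=
          Finset.sum_congr rfl fun v hv => padicHaar_coneGroup_toReal (by rw [hTl v hv, hqn]) k
      _ = (T.card : ℝ) * (((p : ℝ) ^ k) ^ (n - 1))⁻¹ := by rw [Finset.sum_const, nsmul_eq_mul]
      _ ≤ (3 * (q : ℝ)) ^ (n - 1) * (((p : ℝ) ^ k) ^ (n - 1))⁻¹ := by gcongr
      _ = _ := by rw [mul_pow]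
end
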